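/- arXiv:2204.09174 — 2 statements merged into one kernel-verified Lean document; each statement's English description precedes it below -/
import Mathlib

section
/- In a right-angled Coxeter group, if an element y covers two distinct elements x₁, x₂ in Bruhat order and s is a common left descent of x₁ and x₂, then s is a left descent of y. -/
open CoxeterSystem

variable {B W : Type*} [Group W] {M : CoxeterMatrix B}

/-- One step of Bruhat order: multiply on the right by a reflection, increasing length. -/
def bruhatStep (cs : CoxeterSystem M W) (x y : W) : Prop :=
  ∃ t : W, cs.IsReflection t ∧ y = x * t ∧ cs.length x < cs.length y

/-- Bruhat order on a Coxeter group. -/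
def bruhatLE (cs : CoxeterSystem M W) : W → W → Prop :=
  Relation.ReflTransGen (bruhatStep cs)

/-- Strict Bruhat order. -/
def bruhatLT (cs : CoxeterSystem M W) (x y : W) : Prop :=
  bruhatLE cs x y ∧ x ≠ y

/-- Cover relation in Bruhat order. -/
def bruhatCovBy (cs : CoxeterSystem M W) (x y : W) : Prop :=
  bruhatLE cs x y ∧ cs.length y = cs.length x + 1

/-- The Bruhat interval `[u, v]`. -/
def bruhatInterval (cs : CoxeterSystem M W) (u v : W) : Set W :=
  {x | bruhatLE cs u x ∧ bruhatLE cs x v}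

/-- The support of `w`: simple reflections appearing in a reduced word for `w`. -/
def supp (cs : CoxeterSystem M W) (w : W) : Set B :=
  {i | ∃ ω : List B, cs.IsReduced ω ∧ w = cs.wordProd ω ∧ i ∈ ω}

namespace CoxeterSystem

open Classical in
/-- The action of a simple reflection on `W × ZMod 2`: conjugation on the first component, and
a flip of the sign exactly at the simple reflection itself. -/
noncomputable def signedConj (cs : CoxeterSystem M W) (b : B) : Equiv.Perm (W × ZMod 2) :=
  Function.Involutive.toPerm
    (fun p => (cs.simple b * p.1 * cs.simple b, p.2 + if p.1 = cs.simple b then 1 else 0)) (by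
      rintro ⟨t, e⟩
      have h : cs.simple b * t * cs.simple b = cs.simple b ↔ t = cs.simple b := by
        constructor
        · intro h
          have := congrArg (fun x => cs.simple b * x * cs.simple b) h
          simpa [mul_assoc] using this
        · rintro rfl
          simp
      ext
      · simp [mul_assoc]
      · simp only [h, add_assoc, CharTwo.add_self_eq_zero, add_zero])

open Classical in
theorem signedConj_apply (cs : CoxeterSystem M W) (b : B) (t : W) (e : ZMod 2) :
    cs.signedConj b (t, e) =
      (cs.simple b * t * cs.simple b, e + if t = cs.simple b then 1 else 0) := rfl

theorem signedConj_mul_self (cs : CoxeterSystem M W) (b : B) :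
    cs.signedConj b * cs.signedConj b = 1 :=
  Equiv.ext fun p => (cs.signedConj b).apply_symm_apply p

theorem commute_of_eq_two (cs : CoxeterSystem M W) {i j : B} (h : M i j = 2) :
    Commute (cs.simple i) (cs.simple j) := by
  have h1 := cs.simple_mul_simple_pow i j
  rw [h, pow_two] at h1
  have h2 := eq_inv_of_mul_eq_one_left h1
  rwa [mul_inv_rev, inv_simple, inv_simple] at h2

theorem signedConj_commute (cs : CoxeterSystem M W) {i j : B}
    (h : Commute (cs.simple i) (cs.simple j)) :
    Commute (cs.signedConj i) (cs.signedConj j) := by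
  classical
  have key : ∀ (k l : B), Commute (cs.simple k) (cs.simple l) → ∀ t : W,
      cs.simple l * t * cs.simple l = cs.simple k ↔ t = cs.simple k := by
    intro k l h t
    constructor
    · intro h1
      have h2 := congrArg (fun x => cs.simple l * x * cs.simple l) h1
      simpa [mul_assoc, h.eq] using h2
    · rintro rfl
      rw [← h.eq, mul_assoc, simple_mul_simple_self, mul_one]
  refine Equiv.ext ?_
  rintro ⟨t, e⟩
  simp only [Equiv.Perm.mul_apply, signedConj_apply]
  refine Prod.ext ?_ ?_
  · simp only [← mul_assoc, h.eq]
    simp only [mul_assoc, h.eq]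
  · simp only [key i j h t, key j i h.symm t]
    exact add_right_comm _ _ _

theorem isLiftable_of_rightAngled
    (hra : ∀ i j : B, i ≠ j → M i j = 2 ∨ M i j = 0) {G : Type*} [Monoid G] (f : B → G)
    (hself : ∀ i, f i * f i = 1) (hcomm : ∀ i j, M i j = 2 → Commute (f i) (f j)) :
    M.IsLiftable f := by
  intro i j
  by_cases hij : i = j
  · subst hij
    rw [hself, one_pow]
  · rcases hra i j hij with h | h
    · rw [h, (hcomm i j h).mul_pow, pow_two, pow_two, hself, hself, one_mul]
    · rw [h, pow_zero]

/-- The action of a right-angled Coxeter group on `W × ZMod 2` extending `signedConj`. -/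
noncomputable def signedConjHom (cs : CoxeterSystem M W)
    (hra : ∀ i j : B, i ≠ j → M i j = 2 ∨ M i j = 0) : W →* Equiv.Perm (W × ZMod 2) :=
  cs.lift ⟨cs.signedConj, isLiftable_of_rightAngled hra _ cs.signedConj_mul_self
    fun _ _ h => cs.signedConj_commute (cs.commute_of_eq_two h)⟩

theorem signedConjHom_simple (cs : CoxeterSystem M W)
    (hra : ∀ i j : B, i ≠ j → M i j = 2 ∨ M i j = 0) (b : B) :
    cs.signedConjHom hra (cs.simple b) = cs.signedConj b :=
  cs.lift_apply_simple _ b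

/-- The reflection cocycle: for a reflection `t`, its value at `(w, t)` is the parity of the
number of occurrences of `t` in the left inversion sequence of any word for `w`. -/
noncomputable def inversionParity (cs : CoxeterSystem M W)
    (hra : ∀ i j : B, i ≠ j → M i j = 2 ∨ M i j = 0) (w t : W) : ZMod 2 :=
  (cs.signedConjHom hra w⁻¹ (t, 0)).2

section RightAngled

variable (cs : CoxeterSystem M W)

theorem signedConjHom_apply
    (hra : ∀ i j : B, i ≠ j → M i j = 2 ∨ M i j = 0)
    (w t : W) (e : ZMod 2) :
    cs.signedConjHom hra w (t, e) =
      (w * t * w⁻¹, e + (cs.signedConjHom hra w (t, 0)).2) := by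
  induction w using cs.simple_induction_left generalizing t e with
  | one => simp
  | mul_simple_left w b ih =>
    rw [map_mul, Equiv.Perm.mul_apply, Equiv.Perm.mul_apply, ih t e, ih t 0,
      signedConjHom_simple, signedConj_apply, signedConj_apply]
    simp [mul_assoc, add_assoc]

theorem inversionParity_one
    (hra : ∀ i j : B, i ≠ j → M i j = 2 ∨ M i j = 0)
    (t : W) : cs.inversionParity hra 1 t = 0 := by
  simp [inversionParity]

theorem inversionParity_mul
    (hra : ∀ i j : B, i ≠ j → M i j = 2 ∨ M i j = 0)
    (u v t : W) :
    cs.inversionParity hra (u * v) t =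
      cs.inversionParity hra u t + cs.inversionParity hra v (u⁻¹ * t * u) := by
  unfold inversionParity
  rw [mul_inv_rev, map_mul, Equiv.Perm.mul_apply, signedConjHom_apply cs hra u⁻¹,
    signedConjHom_apply cs hra v⁻¹]
  simp

theorem inversionParity_simple_self
    (hra : ∀ i j : B, i ≠ j → M i j = 2 ∨ M i j = 0)
    (b : B) :
    cs.inversionParity hra (cs.simple b) (cs.simple b) = 1 := by
  simp [inversionParity, signedConjHom_simple, signedConj_apply]

theorem inversionParity_simple_of_ne
    (hra : ∀ i j : B, i ≠ j → M i j = 2 ∨ M i j = 0)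
    {b : B} {t : W} (h : t ≠ cs.simple b) :
    cs.inversionParity hra (cs.simple b) t = 0 := by
  simp [inversionParity, signedConjHom_simple, signedConj_apply, h]

theorem inversionParity_simple_mul_of_ne
    (hra : ∀ i j : B, i ≠ j → M i j = 2 ∨ M i j = 0)
    {b : B} {t : W} (h : t ≠ cs.simple b) (w : W) :
    cs.inversionParity hra (cs.simple b * w) t =
      cs.inversionParity hra w (cs.simple b * t * cs.simple b) := by
  rw [inversionParity_mul, inversionParity_simple_of_ne cs hra h, zero_add, inv_simple]

theorem inversionParity_self
    (hra : ∀ i j : B, i ≠ j → M i j = 2 ∨ M i j = 0)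
    {t : W} (ht : cs.IsReflection t) :
    cs.inversionParity hra t t = 1 := by
  obtain ⟨u, b, rfl⟩ := ht
  have h := inversionParity_mul cs hra u u⁻¹ (u * cs.simple b * u⁻¹)
  rw [mul_inv_cancel, inversionParity_one] at h
  have e : u⁻¹ * (u * cs.simple b * u⁻¹) * u = cs.simple b := by group
  rw [e] at h
  rw [mul_assoc u, inversionParity_mul, ← mul_assoc u, e, inversionParity_mul, inv_simple,
    simple_mul_simple_self, one_mul, inversionParity_simple_self, add_left_comm, ← h, add_zero]

theorem length_mul_wordProd_lt
    (hra : ∀ i j : B, i ≠ j → M i j = 2 ∨ M i j = 0)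
    {ω : List B} {t : W}
    (h : cs.inversionParity hra (cs.wordProd ω) t ≠ 0) :
    cs.length (t * cs.wordProd ω) < ω.length := by
  induction ω generalizing t with
  | nil => simp [inversionParity_one] at h
  | cons b ω ih =>
    rw [wordProd_cons] at h ⊢
    by_cases htb : t = cs.simple b
    · subst htb
      rw [simple_mul_simple_cancel_left]
      exact Nat.lt_succ_of_le (cs.length_wordProd_le ω)
    · rw [inversionParity_simple_mul_of_ne cs hra htb] at h
      have h1 := ih h
      have h2 := cs.length_mul_le (cs.simple b)
        (cs.simple b * t * cs.simple b * cs.wordProd ω)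
      rw [length_simple, mul_assoc, mul_assoc, simple_mul_simple_cancel_left] at h2
      rw [mul_assoc, mul_assoc] at h1
      rw [List.length_cons]
      omega

theorem length_mul_lt_of_inversionParity_ne_zero
    (hra : ∀ i j : B, i ≠ j → M i j = 2 ∨ M i j = 0)
    {w t : W}
    (h : cs.inversionParity hra w t ≠ 0) : cs.length (t * w) < cs.length w := by
  obtain ⟨ω, hω, rfl⟩ := cs.exists_isReduced w
  rw [hω.eq]
  exact cs.length_mul_wordProd_lt hra h

theorem inversionParity_ne_zero_iff
    (hra : ∀ i j : B, i ≠ j → M i j = 2 ∨ M i j = 0)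
    {w t : W} (ht : cs.IsReflection t) :
    cs.inversionParity hra w t ≠ 0 ↔ cs.length (t * w) < cs.length w := by
  refine ⟨cs.length_mul_lt_of_inversionParity_ne_zero hra, fun hlt h0 => ?_⟩
  have h1 : cs.inversionParity hra (t * w) t ≠ 0 := by
    rw [inversionParity_mul, inversionParity_self cs hra ht, ht.inv, ht.mul_self, one_mul, h0]
    decide
  have h2 := cs.length_mul_lt_of_inversionParity_ne_zero hra h1
  rw [← mul_assoc, ht.mul_self, one_mul] at h2
  omega

theorem isLeftDescent_iff_inversionParity
    (hra : ∀ i j : B, i ≠ j → M i j = 2 ∨ M i j = 0)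
    {w : W} {b : B} :
    cs.IsLeftDescent w b ↔ cs.inversionParity hra w (cs.simple b) ≠ 0 :=
  (cs.inversionParity_ne_zero_iff hra (cs.isReflection_simple b)).symm

theorem isLeftDescent_simple_mul_iff
    (hra : ∀ i j : B, i ≠ j → M i j = 2 ∨ M i j = 0)
    {a b : B} (hne : cs.simple b ≠ cs.simple a)
    (hcomm : Commute (cs.simple a) (cs.simple b)) (w : W) :
    cs.IsLeftDescent (cs.simple a * w) b ↔ cs.IsLeftDescent w b := by
  rw [isLeftDescent_iff_inversionParity cs hra, isLeftDescent_iff_inversionParity cs hra,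
    inversionParity_simple_mul_of_ne cs hra hne, hcomm.eq, simple_mul_simple_cancel_right]

theorem simple_mul_simple_pow_ne_one
    (hra : ∀ i j : B, i ≠ j → M i j = 2 ∨ M i j = 0)
    {a b : B} (hab : a ≠ b) (h0 : M a b = 0) (n : ℕ) :
    (cs.simple a * cs.simple b) ^ (n + 1) ≠ 1 := by
  classical
  intro h
  let f : B → DihedralGroup 0 := fun c =>
    if c = a then DihedralGroup.sr 0 else if c = b then DihedralGroup.sr 1 else 1
  have hf : M.IsLiftable f := by
    refine isLiftable_of_rightAngled hra f (fun i => ?_) fun i j hij => ?_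
    · simp only [f]
      split_ifs <;> simp
    · have h0' : M b a = 0 := by rw [M.symmetric, h0]
      simp only [f]
      split_ifs <;> first | exact Commute.one_right _ | exact Commute.one_left _ |
        exact Commute.refl _ | (subst_vars; omega)
  have h1 := congrArg (cs.lift ⟨f, hf⟩) h
  rw [map_pow, map_mul, cs.lift_apply_simple hf, cs.lift_apply_simple hf, map_one] at h1
  simp only [f, if_true, if_neg hab.symm, DihedralGroup.sr_mul_sr, sub_zero] at h1
  have h2 := orderOf_dvd_of_pow_eq_one h1
  rw [DihedralGroup.orderOf_r_one] at h2
  simp at h2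

/-- The alternating product `a b a ⋯` with `n` factors. -/
def alternatingProd (cs : CoxeterSystem M W) : ℕ → B → B → W
  | 0, _, _ => 1
  | n + 1, a, b => cs.simple a * alternatingProd cs n b a

theorem inversionParity_alternatingProd
    (hra : ∀ i j : B, i ≠ j → M i j = 2 ∨ M i j = 0)
    {a b : B} (hab : a ≠ b) (h0 : M a b = 0) (n j : ℕ) :
    cs.inversionParity hra (cs.alternatingProd n a b)
      ((cs.simple b * cs.simple a) ^ j * cs.simple b) = 0 := by
  induction n generalizing a b j with
  | zero => exact cs.inversionParity_one hra _
  | succ n ih =>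
    have h0' : M b a = 0 := by rw [M.symmetric, h0]
    rw [alternatingProd, inversionParity_simple_mul_of_ne]
    · have e : cs.simple a * ((cs.simple b * cs.simple a) ^ j * cs.simple b) * cs.simple a =
          (cs.simple a * cs.simple b) ^ (j + 1) * cs.simple a := by
        rw [pow_succ, ← mul_assoc _ (cs.simple a) (cs.simple b),
          mul_pow_mul (cs.simple a)]
        simp only [mul_assoc]
      rw [e]
      exact ih hab.symm h0' (j + 1)
    · intro h
      apply cs.simple_mul_simple_pow_ne_one hra hab.symm h0' j
      rw [pow_succ, ← mul_assoc, h, simple_mul_simple_self]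

theorem exists_eq_alternatingProd_mul
    (hra : ∀ i j : B, i ≠ j → M i j = 2 ∨ M i j = 0)
    {a b : B} (hab : a ≠ b) (h0 : M a b = 0) {w : W}
    (ha : cs.IsLeftDescent w a) (hb : cs.IsLeftDescent w b) (n : ℕ) :
    ∃ v, w = cs.alternatingProd n a b * v ∧ cs.length v + n ≤ cs.length w := by
  induction n generalizing a b with
  | zero => exact ⟨w, by simp [alternatingProd], le_rfl⟩
  | succ n ih =>
    have h0' : M b a = 0 := by rw [M.symmetric, h0]
    obtain ⟨v, hv, hlen⟩ := ih hab.symm h0' hb ha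
    rw [isLeftDescent_iff_inversionParity cs hra, hv, inversionParity_mul] at ha
    have hz := cs.inversionParity_alternatingProd hra hab.symm h0' n 0
    rw [pow_zero, one_mul] at hz
    rw [hz, zero_add] at ha
    have hlt := cs.length_mul_lt_of_inversionParity_ne_zero hra ha
    refine ⟨(cs.alternatingProd n b a)⁻¹ * cs.simple a * cs.alternatingProd n b a * v, ?_, ?_⟩
    · rw [alternatingProd, hv]
      simp [mul_assoc]
    · omega

/-- Two distinct left descents of an element of a right-angled Coxeter group commute. -/
theorem commute_of_isLeftDescent
    (hra : ∀ i j : B, i ≠ j → M i j = 2 ∨ M i j = 0)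
    {a b : B} {w : W}
    (ha : cs.IsLeftDescent w a) (hb : cs.IsLeftDescent w b) :
    Commute (cs.simple a) (cs.simple b) := by
  by_cases hab : a = b
  · rw [hab]
  · refine cs.commute_of_eq_two ((hra a b hab).resolve_right fun h0 => ?_)
    obtain ⟨v, -, hv⟩ := cs.exists_eq_alternatingProd_mul hra hab h0 ha hb (cs.length w + 1)
    omega

theorem isLeftDescent_of_mul_reflection
    (hra : ∀ i j : B, i ≠ j → M i j = 2 ∨ M i j = 0)
    {b : B} {y t₁ t₂ : W}
    (ht₁ : cs.IsReflection t₁) (ht₂ : cs.IsReflection t₂) (hne : t₁ ≠ t₂)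
    (hl₁ : cs.length (t₁ * y) + 1 = cs.length y) (hl₂ : cs.length (t₂ * y) + 1 = cs.length y)
    (hd₁ : cs.IsLeftDescent (t₁ * y) b) (hd₂ : cs.IsLeftDescent (t₂ * y) b) :
    cs.IsLeftDescent y b := by
  induction hn : cs.length y generalizing y t₁ t₂ with
  | zero => omega
  | succ n ih =>
    have hy1 : y ≠ 1 := by
      rintro rfl
      simp at hn
    obtain ⟨a, ha⟩ := cs.exists_leftDescent_of_ne_one hy1
    by_cases hab : cs.simple b = cs.simple a
    · rw [IsLeftDescent, hab]
      exact ha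
    have hay := cs.isLeftDescent_iff.1 ha
    have lower : ∀ t : W, cs.IsReflection t → cs.length (t * y) + 1 = cs.length y →
        t ≠ cs.simple a → cs.IsLeftDescent (t * y) a := by
      intro t ht hl hta
      have h := (cs.inversionParity_ne_zero_iff hra ht (w := y)).2 (by omega)
      rw [← cs.simple_mul_simple_cancel_left (w := y) a,
        inversionParity_simple_mul_of_ne cs hra hta] at h
      have h2 := cs.length_mul_lt_of_inversionParity_ne_zero hra h
      simp only [mul_assoc, simple_mul_simple_cancel_left] at h2
      rw [IsLeftDescent]
      omega
    have hcomm : Commute (cs.simple a) (cs.simple b) := by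
      by_cases h : t₁ = cs.simple a
      · have h' : t₂ ≠ cs.simple a := fun h' => hne (h.trans h'.symm)
        exact cs.commute_of_isLeftDescent hra (lower t₂ ht₂ hl₂ h') hd₂
      · exact cs.commute_of_isLeftDescent hra (lower t₁ ht₁ hl₁ h) hd₁
    by_cases h₁ : t₁ = cs.simple a
    · rw [h₁] at hd₁
      exact (cs.isLeftDescent_simple_mul_iff hra hab hcomm y).1 hd₁
    by_cases h₂ : t₂ = cs.simple a
    · rw [h₂] at hd₂
      exact (cs.isLeftDescent_simple_mul_iff hra hab hcomm y).1 hd₂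
    rw [← cs.isLeftDescent_simple_mul_iff hra hab hcomm y]
    have e : ∀ t : W, cs.simple a * t * (cs.simple a)⁻¹ * (cs.simple a * y) =
        cs.simple a * (t * y) := fun t => by group
    have hda₁ := cs.isLeftDescent_iff.1 (lower t₁ ht₁ hl₁ h₁)
    have hda₂ := cs.isLeftDescent_iff.1 (lower t₂ ht₂ hl₂ h₂)
    refine ih (ht₁.conj (cs.simple a)) (ht₂.conj (cs.simple a)) (by simpa using hne) ?_ ?_ ?_ ?_
      (by omega)
    · rw [e]
      omega
    · rw [e]
      omega
    · rw [e]
      exact (cs.isLeftDescent_simple_mul_iff hra hab hcomm _).2 hd₁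
    · rw [e]
      exact (cs.isLeftDescent_simple_mul_iff hra hab hcomm _).2 hd₂

end RightAngled

end CoxeterSystem

theorem bruhatLE.eq_or_length_lt {cs : CoxeterSystem M W} {x y : W} (h : bruhatLE cs x y) :
    x = y ∨ cs.length x < cs.length y := by
  induction h with
  | refl => exact Or.inl rfl
  | tail _ hstep ih =>
    obtain ⟨t, -, -, hlt⟩ := hstep
    rcases ih with rfl | h
    · exact Or.inr hlt
    · exact Or.inr (h.trans hlt)

theorem bruhatCovBy.exists_reflection_mul {cs : CoxeterSystem M W} {x y : W}
    (h : bruhatCovBy cs x y) : ∃ t, cs.IsReflection t ∧ x = t * y := by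
  obtain ⟨hle, hlen⟩ := h
  rcases Relation.ReflTransGen.cases_head hle with rfl | ⟨z, ⟨t, ht, rfl, hlt⟩, hzy⟩
  · omega
  · rcases bruhatLE.eq_or_length_lt hzy with rfl | hlt'
    · refine ⟨_, ht.conj x, ?_⟩
      rw [← mul_assoc, inv_mul_cancel_right, mul_assoc, ht.mul_self, mul_one]
    · omega

/-- In a right-angled Coxeter group, if `y` covers two distinct elements `x₁, x₂` and `b` is
a common left descent of `x₁` and `x₂`, then `b` is a left descent of `y`. -/
theorem stmt9 (cs : CoxeterSystem M W)
    (hra : ∀ i j : B, i ≠ j → M i j = 2 ∨ M i j = 0)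
    (x₁ x₂ y : W) (hne : x₁ ≠ x₂)
    (h₁ : bruhatCovBy cs x₁ y) (h₂ : bruhatCovBy cs x₂ y)
    (b : B) (hd₁ : cs.IsLeftDescent x₁ b) (hd₂ : cs.IsLeftDescent x₂ b) :
    cs.IsLeftDescent y b := by
  obtain ⟨t₁, ht₁, rfl⟩ := h₁.exists_reflection_mul
  obtain ⟨t₂, ht₂, rfl⟩ := h₂.exists_reflection_mul
  exact cs.isLeftDescent_of_mul_reflection hra ht₁ ht₂ (fun h => hne (by rw [h])) h₁.2.symm
    h₂.2.symm hd₁ hd₂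
end

section
/- Let u ≤ v be elements of a Coxeter group W and let M be a special matching of the Hasse diagram of the Bruhat interval [u,v]. If x, y ∈ [u,v] with ℓ(y) − ℓ(x) = 1 and x ⋖ y, then M(x) and M(y) differ by right multiplication by a reflection (i.e., {M(x), M(y)} is an edge of the undirected Bruhat graph Γ(u,v)). -/
open CoxeterSystem

variable {B W : Type*} [Group W] {M : CoxeterMatrix B}

namespace CoxeterSystem

/-- The real vector space with basis the simple roots, extended by its dual so that the canonical
symmetric form separates the points of the first summand. -/
abbrev RootSpace (B : Type*) := (B →₀ ℝ) × Module.Dual ℝ (B →₀ ℝ)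

/-- The simple root attached to `i`. -/
noncomputable def simpleRoot (i : B) : RootSpace B := (Finsupp.single i 1, 0)

/-- The canonical symmetric bilinear form on the space of simple roots. -/
noncomputable def rootForm (M : CoxeterMatrix B) : (B →₀ ℝ) →ₗ[ℝ] Module.Dual ℝ (B →₀ ℝ) :=
  Finsupp.linearCombination ℝ fun i ↦
    Finsupp.linearCombination ℝ fun j ↦ -Real.cos (Real.pi / M i j)

theorem rootForm_comm (M : CoxeterMatrix B) (v w : B →₀ ℝ) :
    rootForm M v w = rootForm M w v := by
  have h : rootForm M = (rootForm M).flip := by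
    ext i j
    simp [rootForm, M.symmetric i j]
  conv_lhs => rw [h]
  rfl

/-- The symmetric bilinear form on `RootSpace B`. -/
noncomputable def form (M : CoxeterMatrix B) : LinearMap.BilinForm ℝ (RootSpace B) :=
  LinearMap.mk₂ ℝ (fun x y ↦ rootForm M x.1 y.1 + x.2 y.1 + y.2 x.1)
    (fun x x' y ↦ by simp; ring) (fun c x y ↦ by simp; ring)
    (fun x y y' ↦ by simp; ring) (fun c x y ↦ by simp; ring)

theorem form_apply (M : CoxeterMatrix B) (x y : RootSpace B) :
    form M x y = rootForm M x.1 y.1 + x.2 y.1 + y.2 x.1 := rfl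

theorem form_comm (M : CoxeterMatrix B) (x y : RootSpace B) : form M x y = form M y x := by
  rw [form_apply, form_apply, rootForm_comm]
  ring

theorem form_simpleRoot (M : CoxeterMatrix B) (i j : B) :
    form M (simpleRoot i) (simpleRoot j) = -Real.cos (Real.pi / M i j) := by
  simp [form_apply, simpleRoot, rootForm]

theorem form_simpleRoot_self (M : CoxeterMatrix B) (i : B) :
    form M (simpleRoot i) (simpleRoot i) = 1 := by
  simp [form_simpleRoot]

theorem two_form_simpleRoot_self (M : CoxeterMatrix B) (i : B) :
    ((2 : ℝ) • form M (simpleRoot i)) (simpleRoot i) = 2 := by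
  simp [form_simpleRoot]

/-- The orthogonal reflection in the simple root attached to `i`. -/
noncomputable def simpleReflection (M : CoxeterMatrix B) (i : B) :
    RootSpace B ≃ₗ[ℝ] RootSpace B :=
  Module.reflection (two_form_simpleRoot_self M i)

theorem simpleReflection_apply (M : CoxeterMatrix B) (i : B) (x : RootSpace B) :
    simpleReflection M i x = x - (2 * form M (simpleRoot i) x) • simpleRoot i := by
  simp [simpleReflection, Module.reflection_apply]

theorem sin_pi_div_pos {m : ℕ} (hm : 2 ≤ m) : 0 < Real.sin (Real.pi / m) := by
  have hm' : (2 : ℝ) ≤ m := by exact_mod_cast hm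
  apply Real.sin_pos_of_pos_of_lt_pi
  · positivity
  · exact div_lt_self Real.pi_pos (by linarith)

open Polynomial.Chebyshev in
theorem isLiftable_simpleReflection (M : CoxeterMatrix B) : M.IsLiftable (simpleReflection M) := by
  intro i j
  by_cases hij : i = j
  · subst hij
    rw [M.diagonal, pow_one]
    ext1 x
    exact Module.involutive_reflection (two_form_simpleRoot_self M i) x
  ext1 x
  have h1 : M i j ≠ 1 := M.off_diagonal i j hij
  obtain h0 | h2 | h3 : M i j = 0 ∨ M i j = 2 ∨ 3 ≤ M i j := by omega
  · simp [h0]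
  · have ha : form M (simpleRoot i) (simpleRoot j) = 0 := by
      simp [form_simpleRoot, h2]
    have hb : form M (simpleRoot j) (simpleRoot i) = 0 := by rw [form_comm, ha]
    rw [h2, pow_two]
    change _ = x
    simp only [LinearEquiv.mul_apply, simpleReflection_apply, map_sub, map_smul, ha, hb,
      form_simpleRoot_self]
    module
  · set m := M i j with hm
    have hc : form M (simpleRoot j) (simpleRoot i) = -Real.cos (Real.pi / m) := by
      rw [form_simpleRoot, M.symmetric j i]
    have hc' : form M (simpleRoot i) (simpleRoot j) = -Real.cos (Real.pi / m) :=
      form_simpleRoot M i j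
    have hm0 : (m : ℝ) ≠ 0 := by
      have : m ≠ 0 := by omega
      exact_mod_cast this
    have hmR : (3 : ℝ) ≤ m := by exact_mod_cast h3
    set θ : ℝ := 2 * (Real.pi / m) with hθ
    have hsin : Real.sin θ ≠ 0 := by
      apply ne_of_gt
      apply Real.sin_pos_of_pos_of_lt_pi
      · have := Real.pi_pos
        positivity
      · rw [hθ, mul_div_assoc', div_lt_iff₀ (by linarith)]
        nlinarith [Real.pi_pos]
    have key := Module.reflection_mul_reflection_pow_apply (two_form_simpleRoot_self M i)
      (two_form_simpleRoot_self M j) m x (2 * Real.cos θ) (by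
        simp only [LinearMap.smul_apply, smul_eq_mul, hc, hc', hθ, Real.cos_two_mul]
        ring)
    have hS (n : ℤ) := S_two_mul_real_cos θ n
    have hm1 : (m : ℝ) * θ = 2 * Real.pi := by rw [hθ]; field_simp
    rw [show simpleReflection M i * simpleReflection M j = _ from rfl]
    change ((Module.reflection (two_form_simpleRoot_self M i) *
      Module.reflection (two_form_simpleRoot_self M j)) ^ m) x = x
    rw [key]
    obtain ⟨k, hk⟩ | ⟨k, hk⟩ := Nat.even_or_odd m
    · have e1 : ((m : ℤ) - 2) / 2 = k - 1 := by omega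
      have e2 : ((m : ℤ) - 1) / 2 = k - 1 := by omega
      have z : (S ℝ ((k : ℤ) - 1)).eval (2 * Real.cos θ) = 0 := by
        have := hS ((k : ℤ) - 1)
        have hkk : (k : ℝ) * θ = Real.pi := by
          have : (m : ℝ) = k + k := by exact_mod_cast hk
          rw [this] at hm1
          linarith
        push_cast at this
        rw [sub_add_cancel, hkk, Real.sin_pi] at this
        exact (mul_eq_zero.mp this).resolve_right hsin
      rw [e1, e2, z]
      simp
    · have e1 : ((m : ℤ) - 2) / 2 = k - 1 := by omega
      have e2 : ((m : ℤ) - 1) / 2 = k := by omega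
      have e3 : ((m : ℤ) - 3) / 2 = k - 1 := by omega
      have e4 : (m : ℤ) / 2 = k := by omega
      have z : (S ℝ (k : ℤ)).eval (2 * Real.cos θ) + (S ℝ ((k : ℤ) - 1)).eval (2 * Real.cos θ)
          = 0 := by
        have h1 := hS ((k : ℤ) - 1)
        have h2 := hS (k : ℤ)
        have hkk : ((k : ℝ) + 1) * θ = 2 * Real.pi - k * θ := by
          have : (m : ℝ) = 2 * k + 1 := by exact_mod_cast hk
          rw [this] at hm1
          linarith
        push_cast at h1 h2
        rw [sub_add_cancel] at h1
        rw [hkk, Real.sin_two_pi_sub] at h2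
        refine (mul_eq_zero.mp ?_).resolve_right hsin
        rw [add_mul, h1, h2]
        ring
      rw [e1, e2, e3, e4, z]
      simp

/-- The geometric representation of a Coxeter group on `RootSpace B`. -/
noncomputable def geomRep (cs : CoxeterSystem M W) : W →* (RootSpace B ≃ₗ[ℝ] RootSpace B) :=
  cs.lift ⟨simpleReflection M, isLiftable_simpleReflection M⟩

theorem geomRep_simple (cs : CoxeterSystem M W) (i : B) (x : RootSpace B) :
    cs.geomRep (cs.simple i) x = x - (2 * form M (simpleRoot i) x) • simpleRoot i := by
  rw [geomRep, lift_apply_simple, simpleReflection_apply]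

theorem geomRep_mul_apply (cs : CoxeterSystem M W) (v w : W) (x : RootSpace B) :
    cs.geomRep (v * w) x = cs.geomRep v (cs.geomRep w x) := by
  rw [map_mul, LinearEquiv.mul_apply]

theorem geomRep_one_apply (cs : CoxeterSystem M W) (x : RootSpace B) :
    cs.geomRep 1 x = x := by
  rw [map_one]
  rfl

theorem form_geomRep (cs : CoxeterSystem M W) (w : W) (x y : RootSpace B) :
    form M (cs.geomRep w x) (cs.geomRep w y) = form M x y := by
  induction w using cs.simple_induction_left with
  | one => simp
  | mul_simple_left w i ih =>
    rw [geomRep_mul_apply, geomRep_mul_apply, geomRep_simple, geomRep_simple, ← ih]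
    simp only [map_sub, map_smul, LinearMap.sub_apply, LinearMap.smul_apply, smul_eq_mul,
      form_simpleRoot_self]
    rw [form_comm M (cs.geomRep w x) (simpleRoot i)]
    ring

/-- Nonnegative combinations of simple roots. -/
def Nonneg (x : RootSpace B) : Prop := x.2 = 0 ∧ ∀ i, 0 ≤ x.1 i

theorem nonneg_simpleRoot (i : B) : Nonneg (simpleRoot i) := by
  classical
  refine ⟨rfl, fun j ↦ ?_⟩
  simp only [simpleRoot, Finsupp.single_apply]
  split_ifs <;> norm_num

theorem Nonneg.add {x y : RootSpace B} (hx : Nonneg x) (hy : Nonneg y) : Nonneg (x + y) :=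
  ⟨by simp [hx.1, hy.1], fun i ↦ by simpa using add_nonneg (hx.2 i) (hy.2 i)⟩

theorem Nonneg.smul {x : RootSpace B} (hx : Nonneg x) {c : ℝ} (hc : 0 ≤ c) : Nonneg (c • x) :=
  ⟨by simp [hx.1], fun i ↦ by simpa using mul_nonneg hc (hx.2 i)⟩

theorem Nonneg.eq_zero {x : RootSpace B} (hx : Nonneg x) (hx' : Nonneg (-x)) : x = 0 := by
  refine Prod.ext (Finsupp.ext fun i ↦ le_antisymm ?_ (hx.2 i)) hx.1
  simpa using hx'.2 i

theorem exists_dihedral_coefficients (m : ℕ) (hm : m ≠ 1) : ∃ D : ℕ → ℝ, D 0 = 0 ∧ D 1 = 1 ∧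
    (∀ k, D (k + 2) = 2 * Real.cos (Real.pi / m) * D (k + 1) - D k) ∧
    ∀ k, m = 0 ∨ k ≤ m → 0 ≤ D k := by
  rcases Nat.eq_zero_or_pos m with rfl | hpos
  · refine ⟨fun k ↦ k, by simp, by simp, fun k ↦ ?_, fun k _ ↦ Nat.cast_nonneg k⟩
    simp
    ring
  · have hs := sin_pi_div_pos (m := m) (by omega)
    refine ⟨fun k ↦ Real.sin (k * (Real.pi / m)) / Real.sin (Real.pi / m), by simp, ?_,
      fun k ↦ ?_, fun k hk ↦ ?_⟩
    · simp [hs.ne']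
    · have h1 : ((k + 2 : ℕ) : ℝ) * (Real.pi / m) = (k + 1 : ℕ) * (Real.pi / m) + Real.pi / m := by
        push_cast; ring
      have h2 : (k : ℝ) * (Real.pi / m) = (k + 1 : ℕ) * (Real.pi / m) - Real.pi / m := by
        push_cast; ring
      simp only [h1, h2, Real.sin_add, Real.sin_sub]
      ring
    · refine div_nonneg (Real.sin_nonneg_of_nonneg_of_le_pi ?_ ?_) hs.le
      · have := Real.pi_pos
        positivity
      · have hkm : (k : ℝ) ≤ m := by exact_mod_cast (by omega : k ≤ m)
        have hm0 : (0 : ℝ) < m := by exact_mod_cast hpos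
        rw [mul_div_assoc', div_le_iff₀ hm0]
        nlinarith [Real.pi_pos]

theorem geomRep_alternatingWord (cs : CoxeterSystem M W) {i j : B} (hij : i ≠ j) (k : ℕ)
    (hk : M i j = 0 ∨ k + 1 ≤ M i j) : ∃ p q : ℝ, 0 ≤ p ∧ 0 ≤ q ∧
      cs.geomRep (cs.wordProd (alternatingWord i j k)) (simpleRoot i) =
        p • simpleRoot i + q • simpleRoot j := by
  obtain ⟨D, hD0, hD1, hD, hpos⟩ := exists_dihedral_coefficients (M i j) (M.off_diagonal i j hij)
  have hc : form M (simpleRoot i) (simpleRoot j) = -Real.cos (Real.pi / M i j) :=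
    form_simpleRoot M i j
  have hc' : form M (simpleRoot j) (simpleRoot i) = -Real.cos (Real.pi / M i j) := by
    rw [form_comm, hc]
  have main : cs.geomRep (cs.wordProd (alternatingWord i j k)) (simpleRoot i) =
      if Even k then D (k + 1) • simpleRoot i + D k • simpleRoot j
      else D k • simpleRoot i + D (k + 1) • simpleRoot j := by
    clear hk
    induction k with
    | zero => simp [alternatingWord, hD0, hD1]
    | succ k ih =>
      rw [alternatingWord_succ', wordProd_cons, geomRep_mul_apply, ih]
      by_cases hk : Even k
      · have hk' : ¬ Even (k + 1) := by simp [hk, parity_simps]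
        simp only [hk, hk', if_true, if_false, geomRep_simple, map_add, map_smul,
          form_simpleRoot_self, hc', hD k]
        module
      · have hk' : Even (k + 1) := by simp [hk, parity_simps]
        simp only [hk, hk', if_true, if_false, geomRep_simple, map_add, map_smul,
          form_simpleRoot_self, hc, hD k]
        module
  have h1 : 0 ≤ D k := hpos k (by omega)
  have h2 : 0 ≤ D (k + 1) := hpos (k + 1) (by omega)
  rw [main]
  split_ifs
  exacts [⟨_, _, h2, h1, rfl⟩, ⟨_, _, h1, h2, rfl⟩]

theorem nonneg_geomRep_simpleRoot (cs : CoxeterSystem M W) (w : W) (i : B)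
    (hw : cs.length w < cs.length (w * cs.simple i)) :
    Nonneg (cs.geomRep w (simpleRoot i)) := by
  classical
  induction hn : cs.length w using Nat.strong_induction_on generalizing w i with
  | _ n ih =>
  by_cases hw1 : w = 1
  · subst hw1
    simpa using nonneg_simpleRoot i
  obtain ⟨j, hj⟩ := cs.exists_rightDescent_of_ne_one hw1
  have hij : i ≠ j := by
    rintro rfl
    exact absurd hw (not_lt.mpr (le_of_lt hj))
  let P : ℕ → Prop := fun k ↦ ∃ v, w = v * cs.wordProd (alternatingWord i j k) ∧
    cs.length w = cs.length v + k
  have hP1 : P 1 := by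
    refine ⟨w * cs.simple j, ?_, ?_⟩
    · simp [alternatingWord]
    · exact (cs.isRightDescent_iff.mp hj).symm
  have hle : ∀ k, P k → k ≤ cs.length w := by
    rintro k ⟨v, -, hv⟩
    omega
  set k := Nat.findGreatest P (cs.length w) with hk
  have hPk : P k := Nat.findGreatest_spec (hle 1 hP1) hP1
  have hk1 : 1 ≤ k := Nat.le_findGreatest (hle 1 hP1) hP1
  have hPs : ¬ P (k + 1) := fun h ↦ by
    have := Nat.le_findGreatest (hle _ h) h
    omega
  obtain ⟨v, hv, hvl⟩ := hPk
  have hnew : cs.length v < cs.length (v * cs.simple (if Even k then j else i)) := by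
    by_contra hcon
    apply hPs
    refine ⟨v * cs.simple (if Even k then j else i), ?_, ?_⟩
    · rw [alternatingWord_succ', wordProd_cons, ← mul_assoc, simple_mul_simple_cancel_right]
      exact hv
    · rcases cs.length_mul_simple v (if Even k then j else i) with h | h <;> omega
  have hold : cs.length v < cs.length (v * cs.simple (if Even k then i else j)) := by
    obtain ⟨l, hl⟩ : ∃ l, k = l + 1 := ⟨k - 1, by omega⟩
    have hp : (if Even k then i else j) = if Even l then j else i := by
      rw [hl]
      by_cases h : Even l <;> simp [h, parity_simps]
    rw [hp]
    by_contra hcon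
    have hw' : w = v * cs.simple (if Even l then j else i) *
        cs.wordProd (alternatingWord i j l) := by
      rw [hv, hl, alternatingWord_succ', wordProd_cons, mul_assoc]
    have h1 := cs.length_mul_le (v * cs.simple (if Even l then j else i))
      (cs.wordProd (alternatingWord i j l))
    rw [← hw'] at h1
    have h2 := cs.length_wordProd_le (alternatingWord i j l)
    rw [length_alternatingWord] at h2
    rcases cs.length_mul_simple v (if Even l then j else i) with h | h <;> omega
  have hvi : cs.length v < cs.length (v * cs.simple i) := by
    by_cases h : Even k <;> simp only [h, if_true, if_false] at hnew hold <;> assumption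
  have hvj : cs.length v < cs.length (v * cs.simple j) := by
    by_cases h : Even k <;> simp only [h, if_true, if_false] at hnew hold <;> assumption
  have hkm : M i j = 0 ∨ k + 1 ≤ M i j := by
    by_contra! hcon
    apply cs.not_isReduced_alternatingWord j i (m := k + 1) (by rw [M.symmetric]; exact hcon.1)
      (by rw [M.symmetric]; exact hcon.2)
    have hwi : w * cs.simple i = v * cs.wordProd (alternatingWord j i (k + 1)) := by
      rw [hv, alternatingWord_succ, wordProd_concat, mul_assoc]
    have h1 := cs.length_mul_le v (cs.wordProd (alternatingWord j i (k + 1)))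
    rw [← hwi] at h1
    have h2 := cs.length_wordProd_le (alternatingWord j i (k + 1))
    rw [IsReduced]
    rw [length_alternatingWord] at h2 ⊢
    omega
  obtain ⟨p, q, hp, hq, hpq⟩ := cs.geomRep_alternatingWord hij k hkm
  rw [hv, geomRep_mul_apply, hpq, map_add, map_smul, map_smul]
  exact ((ih _ (by omega) v i hvi rfl).smul hp).add ((ih _ (by omega) v j hvj rfl).smul hq)

/-- `β` is one of the two roots attached to the reflection `t`. -/
def IsRootOf (cs : CoxeterSystem M W) (t : W) (β : RootSpace B) : Prop :=
  ∃ w i, t = w * cs.simple i * w⁻¹ ∧ β = cs.geomRep w (simpleRoot i)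

variable {cs : CoxeterSystem M W} {t t' : W} {β γ : RootSpace B}

theorem isRootOf_simple (cs : CoxeterSystem M W) (i : B) :
    cs.IsRootOf (cs.simple i) (simpleRoot i) := ⟨1, i, by simp, by simp⟩

theorem IsRootOf.isReflection (h : cs.IsRootOf t β) : cs.IsReflection t := by
  obtain ⟨w, i, rfl, -⟩ := h
  exact ⟨w, i, rfl⟩

theorem IsRootOf.conj (h : cs.IsRootOf t β) (w : W) :
    cs.IsRootOf (w * t * w⁻¹) (cs.geomRep w β) := by
  obtain ⟨v, i, rfl, rfl⟩ := h
  exact ⟨w * v, i, by group, by rw [geomRep_mul_apply]⟩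

theorem IsRootOf.form_self (h : cs.IsRootOf t β) : form M β β = 1 := by
  obtain ⟨w, i, -, rfl⟩ := h
  rw [form_geomRep, form_simpleRoot_self]

theorem IsRootOf.geomRep_apply (h : cs.IsRootOf t β) (x : RootSpace B) :
    cs.geomRep t x = x - (2 * form M β x) • β := by
  obtain ⟨w, i, rfl, rfl⟩ := h
  have hx : x = cs.geomRep w (cs.geomRep w⁻¹ x) := by
    rw [← geomRep_mul_apply, mul_inv_cancel, geomRep_one_apply]
  conv_rhs => rw [hx, form_geomRep]
  rw [geomRep_mul_apply, geomRep_mul_apply, geomRep_simple, map_sub, map_smul]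

theorem IsRootOf.geomRep_self (h : cs.IsRootOf t β) : cs.geomRep t β = -β := by
  rw [h.geomRep_apply, h.form_self]
  module

theorem IsRootOf.neg (h : cs.IsRootOf t β) : cs.IsRootOf t (-β) := by
  have := h.conj t
  rwa [h.geomRep_self, h.isReflection.inv, mul_assoc, h.isReflection.mul_self, mul_one] at this

theorem IsRootOf.nonneg_or (h : cs.IsRootOf t β) : Nonneg β ∨ Nonneg (-β) := by
  obtain ⟨w, i, -, rfl⟩ := h
  rcases cs.length_mul_simple w i with hl | hl
  · exact Or.inl (cs.nonneg_geomRep_simpleRoot w i (by omega))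
  · right
    have := cs.nonneg_geomRep_simpleRoot (w * cs.simple i) i (by
      rw [simple_mul_simple_cancel_right]; omega)
    rwa [geomRep_mul_apply, (cs.isRootOf_simple i).geomRep_self, map_neg] at this

theorem IsRootOf.not_nonneg_neg (h : cs.IsRootOf t β) (hβ : Nonneg β) : ¬ Nonneg (-β) := by
  intro hn
  have := h.form_self
  rw [hβ.eq_zero hn] at this
  simp at this

theorem IsRootOf.snd_eq_zero (h : cs.IsRootOf t β) : β.2 = 0 := by
  rcases h.nonneg_or with h | h
  · exact h.1
  · simpa using h.1

theorem geomRep_injective (cs : CoxeterSystem M W) : Function.Injective cs.geomRep := by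
  rw [injective_iff_map_eq_one]
  intro w hw
  by_contra hne
  obtain ⟨i, hi⟩ := cs.exists_rightDescent_of_ne_one hne
  have := cs.nonneg_geomRep_simpleRoot (w * cs.simple i) i (by
    rw [simple_mul_simple_cancel_right]; exact hi)
  rw [geomRep_mul_apply, (cs.isRootOf_simple i).geomRep_self, hw] at this
  exact (cs.isRootOf_simple i).not_nonneg_neg (nonneg_simpleRoot i) this

theorem IsRootOf.eq_of_smul (h : cs.IsRootOf t β) (h' : cs.IsRootOf t' γ) {c : ℝ}
    (hc : β = c • γ) : t = t' := by
  apply cs.geomRep_injective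
  have h1 := h.form_self
  rw [hc] at h1
  simp only [map_smul, LinearMap.smul_apply, smul_eq_mul, h'.form_self, mul_one] at h1
  ext1 x
  rw [h.geomRep_apply, h'.geomRep_apply, hc]
  simp only [map_smul, LinearMap.smul_apply, smul_eq_mul, smul_smul]
  rw [show 2 * (c * form M γ x) * c = (c * c) * (2 * form M γ x) by ring, h1, one_mul]

theorem IsRootOf.exists_smul_of_eq_zero (h : cs.IsRootOf t β) {i : B}
    (hβ : ∀ j, j ≠ i → β.1 j = 0) : β = β.1 i • simpleRoot i := by
  classical
  refine Prod.ext (Finsupp.ext fun j ↦ ?_) (by simp [h.snd_eq_zero, simpleRoot])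
  by_cases hj : j = i
  · subst hj
    simp [simpleRoot]
  · simp [simpleRoot, hβ j hj, hj]

theorem IsRootOf.nonneg_geomRep_simple (h : cs.IsRootOf t β) (hβ : Nonneg β) {i : B}
    (hne : β ≠ simpleRoot i) : Nonneg (cs.geomRep (cs.simple i) β) := by
  classical
  refine (h.conj (cs.simple i)).nonneg_or.resolve_right fun hn ↦ hne ?_
  have h0 : ∀ j, j ≠ i → β.1 j = 0 := by
    intro j hj
    have := hn.2 j
    rw [geomRep_simple] at this
    simp only [simpleRoot, Prod.fst_neg, Prod.fst_sub, Prod.smul_fst, Finsupp.neg_apply,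
      Finsupp.sub_apply, Finsupp.smul_apply, Finsupp.single_apply, Ne.symm hj, if_false, smul_zero,
      sub_zero] at this
    linarith [hβ.2 j]
  have hs := h.exists_smul_of_eq_zero h0
  have h1 := h.form_self
  rw [hs] at h1
  simp only [map_smul, LinearMap.smul_apply, smul_eq_mul, form_simpleRoot_self, mul_one] at h1
  have h2 : β.1 i = 1 := by nlinarith [hβ.2 i]
  rw [hs, h2, one_smul]

theorem IsReflection.exists_nonneg_root (h : cs.IsReflection t) :
    ∃ β, cs.IsRootOf t β ∧ Nonneg β := by
  obtain ⟨w, i, ht⟩ := h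
  have hr : cs.IsRootOf t (cs.geomRep w (simpleRoot i)) := ⟨w, i, ht, rfl⟩
  rcases hr.nonneg_or with hn | hn
  exacts [⟨_, hr, hn⟩, ⟨_, hr.neg, hn⟩]

theorem IsRootOf.nonneg_of_lt (h : cs.IsRootOf t β) (hβ : Nonneg β) (w : W)
    (hw : cs.length w < cs.length (w * t)) : Nonneg (cs.geomRep w β) := by
  induction hn : cs.length w generalizing w with
  | zero =>
    rw [cs.length_eq_zero_iff.mp hn, geomRep_one_apply]
    exact hβ
  | succ n ih =>
    have hw1 : w ≠ 1 := by
      rintro rfl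
      simp at hn
    obtain ⟨i, hi⟩ := cs.exists_leftDescent_of_ne_one hw1
    rw [isLeftDescent_iff] at hi
    have hlt : cs.length (cs.simple i * w) < cs.length (cs.simple i * w * t) := by
      rw [mul_assoc]
      have hne : cs.length (cs.simple i * w) ≠ cs.length (cs.simple i * (w * t)) := by
        rw [← mul_assoc]
        exact (h.isReflection.length_mul_left_ne _).symm
      rcases cs.length_simple_mul (w * t) i with h' | h' <;> omega
    have hnn := ih _ hlt (by omega)
    have hw' : cs.geomRep w β = cs.geomRep (cs.simple i) (cs.geomRep (cs.simple i * w) β) := by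
      rw [← geomRep_mul_apply, simple_mul_simple_cancel_left]
    rw [hw']
    refine (h.conj _).nonneg_geomRep_simple hnn fun heq ↦ ?_
    have hr := h.conj (cs.simple i * w)
    rw [heq] at hr
    have := hr.eq_of_smul (cs.isRootOf_simple i) (c := 1) (by simp)
    have hwt : w * t = cs.simple i * w := by
      rw [mul_inv_eq_iff_eq_mul, mul_assoc] at this
      exact mul_left_cancel this
    rw [hwt] at hw
    omega

theorem IsRootOf.lt_iff (h : cs.IsRootOf t β) (hβ : Nonneg β) (w : W) :
    cs.length w < cs.length (w * t) ↔ Nonneg (cs.geomRep w β) := by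
  refine ⟨h.nonneg_of_lt hβ w, fun hn ↦ ?_⟩
  by_contra hcon
  have := h.nonneg_of_lt hβ (w * t) (by
    rw [mul_assoc, h.isReflection.mul_self, mul_one]
    exact lt_of_le_of_ne (not_lt.mp hcon) (h.isReflection.length_mul_left_ne w))
  rw [geomRep_mul_apply, h.geomRep_self, map_neg] at this
  exact (h.conj w).not_nonneg_neg hn this

theorem IsRootOf.gt_iff (h : cs.IsRootOf t β) (hβ : Nonneg β) (w : W) :
    cs.length (w * t) < cs.length w ↔ Nonneg (-cs.geomRep w β) := by
  constructor
  · intro hlt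
    refine (h.conj w).nonneg_or.resolve_left fun hn ↦ ?_
    have := (h.lt_iff hβ w).mpr hn
    omega
  · intro hn
    refine lt_of_le_of_ne (not_lt.mp fun hlt ↦ ?_) (h.isReflection.length_mul_left_ne w)
    exact (h.conj w).not_nonneg_neg ((h.lt_iff hβ w).mp hlt) hn

theorem IsRootOf.mul_eq_of_geomRep (h : cs.IsRootOf t β) {w : W} {i : B}
    (hw : cs.geomRep w β = simpleRoot i ∨ cs.geomRep w β = -simpleRoot i) :
    w * t = cs.simple i * w := by
  have hr := h.conj w
  rw [← mul_inv_eq_iff_eq_mul]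
  rcases hw with hw | hw
  · exact hr.eq_of_smul (cs.isRootOf_simple i) (c := 1) (by rw [hw, one_smul])
  · exact hr.eq_of_smul (cs.isRootOf_simple i) (c := -1) (by rw [hw]; module)

theorem IsReflection.mul_eq_simple_mul (h : cs.IsReflection t) {w : W} {i : B}
    (h1 : cs.length w < cs.length (w * t))
    (h2 : cs.length (cs.simple i * (w * t)) < cs.length (cs.simple i * w)) :
    w * t = cs.simple i * w := by
  obtain ⟨β, hr, hβ⟩ := h.exists_nonneg_root
  have h3 := (hr.lt_iff hβ w).mp h1
  rw [← mul_assoc, hr.gt_iff hβ, geomRep_mul_apply] at h2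
  apply hr.mul_eq_of_geomRep
  by_contra! hcon
  exact ((hr.conj w).conj (cs.simple i)).not_nonneg_neg
    ((hr.conj w).nonneg_geomRep_simple h3 hcon.1) h2

theorem exists_combination_of_mul_eq {τ σ τ' σ' : W} {β γ β' γ' : RootSpace B}
    (hτ : cs.IsRootOf τ β) (hσ : cs.IsRootOf σ γ) (hτ' : cs.IsRootOf τ' β')
    (hσ' : cs.IsRootOf σ' γ') (heq : τ * σ = τ' * σ') (hne : τ' ≠ σ') :
    ∃ a b : ℝ, β' = a • β + b • γ := by
  have hmem : β'.1 ∉ Submodule.span ℝ {γ'.1} := by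
    rw [Submodule.mem_span_singleton]
    rintro ⟨c, hc⟩
    refine hne (hτ'.eq_of_smul hσ' (c := c) (Prod.ext hc.symm ?_))
    simp [hτ'.snd_eq_zero, hσ'.snd_eq_zero]
  obtain ⟨f, hf, hker⟩ := Submodule.exists_le_ker_of_notMem hmem
  have hγ' : f γ'.1 = 0 := hker (Submodule.mem_span_singleton_self _)
  have hform (x : RootSpace B) (hx : x.2 = 0) : form M x (0, f) = f x.1 := by
    simp [form_apply, hx]
  have h1 := cs.geomRep_mul_apply τ' σ' (0, f)
  rw [hσ'.geomRep_apply, hform _ hσ'.snd_eq_zero, hγ', mul_zero, zero_smul, sub_zero,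
    hτ'.geomRep_apply, hform _ hτ'.snd_eq_zero, ← heq, geomRep_mul_apply, hτ.geomRep_apply,
    hσ.geomRep_apply] at h1
  set a := form M β ((0, f) - (2 * form M γ (0, f)) • γ)
  set b := form M γ (0, f)
  have h2 : (2 * f β'.1) • β' = (2 * a) • β + (2 * b) • γ := by
    have h3 : (2 * f β'.1) • β' - ((2 * a) • β + (2 * b) • γ) = 0 := by
      rw [← sub_eq_zero] at h1
      rw [← h1]
      module
    exact sub_eq_zero.mp h3
  refine ⟨a / f β'.1, b / f β'.1, ?_⟩
  have h4 : β' = (2 * f β'.1)⁻¹ • ((2 * f β'.1) • β') := by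
    rw [smul_smul, inv_mul_cancel₀ (by simpa using hf), one_smul]
  refine h4.trans ?_
  rw [h2, smul_add, smul_smul, smul_smul]
  congr 2 <;> field_simp

theorem IsRootOf.false_of_isReflection {τ : W} (h : cs.IsRootOf t β) (hτ : cs.IsReflection τ)
    (hne : t ≠ τ) (hβ : Nonneg β) (hβ' : Nonneg (-cs.geomRep τ β)) {y : W}
    (hy : Nonneg (-cs.geomRep y β)) (hyτ : Nonneg (cs.geomRep (y * τ) β))
    (hl : cs.length (y * τ) + 1 = cs.length y) : False := by
  induction hn : cs.length y generalizing y with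
  | zero => omega
  | succ n ih =>
    have hy1 : y ≠ 1 := by
      rintro rfl
      simp at hn
    obtain ⟨i, hi⟩ := cs.exists_leftDescent_of_ne_one hy1
    rw [isLeftDescent_iff] at hi
    have hττ : y * τ * τ = y := by rw [mul_assoc, hτ.mul_self, mul_one]
    rcases cs.length_simple_mul (y * τ) i with hx | hx
    · have heq := hτ.mul_eq_simple_mul (w := y * τ) (i := i) (by rw [hττ]; omega)
        (by rw [hττ]; omega)
      rw [hττ] at heq
      have heq' : y * τ = cs.simple i * y := by
        rw [heq, simple_mul_simple_cancel_left, ← heq]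
      rw [heq', geomRep_mul_apply, geomRep_simple] at hyτ
      have h0 : ∀ j, j ≠ i → (cs.geomRep y β).1 j = 0 := by
        intro j hj
        have h1 := hyτ.2 j
        have h2 := hy.2 j
        simp [simpleRoot, hj] at h1 h2
        linarith
      have := ((h.conj y).eq_of_smul (cs.isRootOf_simple i)
        ((h.conj y).exists_smul_of_eq_zero h0))
      rw [mul_inv_eq_iff_eq_mul, ← heq'] at this
      exact hne (mul_left_cancel this)
    · have hr' := (h.conj τ).neg
      have hxt : cs.geomRep (y * τ) (-cs.geomRep τ β) = -cs.geomRep y β := by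
        rw [map_neg, ← geomRep_mul_apply, hττ]
      refine ih (y := cs.simple i * y) ?_ ?_ (by rw [mul_assoc]; omega) (by omega)
      · rw [geomRep_mul_apply, ← map_neg]
        refine (h.conj y).neg.nonneg_geomRep_simple hy fun heq ↦ ?_
        have h1 := (hr'.lt_iff hβ' (y * τ)).mpr (by rwa [hxt])
        rw [hr'.mul_eq_of_geomRep (Or.inl (hxt.trans heq))] at h1
        omega
      · rw [mul_assoc, geomRep_mul_apply]
        refine (h.conj (y * τ)).nonneg_geomRep_simple hyτ fun heq ↦ ?_
        have h1 := (h.lt_iff hβ (y * τ)).mpr hyτ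
        rw [h.mul_eq_of_geomRep (Or.inl heq)] at h1
        omega

theorem false_of_combination {t₁ t₂ t₃ : W} {β₁ β₂ β₃ : RootSpace B} (h₁ : cs.IsRootOf t₁ β₁)
    (h₂ : cs.IsRootOf t₂ β₂) (h₃ : cs.IsRootOf t₃ β₃) (h₁₂ : t₁ ≠ t₂) (h₃₂ : t₃ ≠ t₂) {p q : ℝ}
    (hp : 0 < p) (hq : 0 < q) (heq : β₂ = p • β₁ + q • β₃) (hn₁ : Nonneg β₁) (hn₃ : Nonneg β₃)
    {y : W} (hy₁ : Nonneg (-cs.geomRep y β₁)) (hy₃ : Nonneg (-cs.geomRep y β₃))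
    (hl : cs.length (y * t₂) + 1 = cs.length y) : False := by
  wlog hc : 1 ≤ p * (2 * form M β₂ β₁) generalizing t₁ t₃ β₁ β₃ p q
  · refine this h₃ h₁ h₃₂ h₁₂ hq hp (by rw [heq, add_comm]) hn₃ hn₁ hy₃ hy₁ ?_
    have h := h₂.form_self
    nth_rw 2 [heq] at h
    simp only [map_add, map_smul, smul_eq_mul] at h
    linarith
  have hc0 : 0 ≤ 2 * form M β₂ β₁ := by
    by_contra! hneg
    nlinarith
  have hτ : -cs.geomRep t₂ β₁ =
      (p * (2 * form M β₂ β₁) - 1) • β₁ + (2 * form M β₂ β₁ * q) • β₃ := by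
    rw [h₂.geomRep_apply]
    generalize form M β₂ β₁ = c
    rw [heq]
    module
  have hc1 : 0 ≤ p * (2 * form M β₂ β₁) - 1 := by linarith
  have hc3 := mul_nonneg hc0 hq.le
  refine h₁.false_of_isReflection h₂.isReflection h₁₂ hn₁ ?_ hy₁ ?_ hl
  · rw [hτ]
    exact (hn₁.smul hc1).add (hn₃.smul hc3)
  · have : cs.geomRep (y * t₂) β₁ = (p * (2 * form M β₂ β₁) - 1) • (-cs.geomRep y β₁) +
        (2 * form M β₂ β₁ * q) • (-cs.geomRep y β₃) := by
      rw [geomRep_mul_apply, ← neg_neg (cs.geomRep t₂ β₁), hτ]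
      simp only [map_neg, map_add, map_smul]
      module
    rw [this]
    exact (hy₁.smul hc1).add (hy₃.smul hc3)

/-- `y` is obtained from `x` by a reflection that increases the length by one. -/
def ReflectionCovBy (cs : CoxeterSystem M W) (x y : W) : Prop :=
  cs.IsReflection (x⁻¹ * y) ∧ cs.length y = cs.length x + 1

theorem isReflection_inv_mul_comm {x y : W} :
    cs.IsReflection (x⁻¹ * y) ↔ cs.IsReflection (y⁻¹ * x) := by
  constructor <;> intro h
  · have := h.inv
    rw [mul_inv_rev, inv_inv] at this
    rwa [this]
  · have := h.inv
    rw [mul_inv_rev, inv_inv] at this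
    rwa [this]

theorem ReflectionCovBy.exists_root {x y : W} (h : cs.ReflectionCovBy x y) :
    ∃ β, cs.IsRootOf (y⁻¹ * x) β ∧ Nonneg β ∧ Nonneg (-cs.geomRep y β) := by
  obtain ⟨β, hr, hβ⟩ := (isReflection_inv_mul_comm.mp h.1).exists_nonneg_root
  refine ⟨β, hr, hβ, (hr.gt_iff hβ y).mp ?_⟩
  rw [mul_inv_cancel_left, h.2]
  omega

theorem ReflectionCovBy.eq_of_three_lower {x₁ x₂ x₃ y y' : W} (h₁₂ : x₁ ≠ x₂) (h₁₃ : x₁ ≠ x₃)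
    (h₂₃ : x₂ ≠ x₃) (h₁ : cs.ReflectionCovBy x₁ y) (h₂ : cs.ReflectionCovBy x₂ y)
    (h₃ : cs.ReflectionCovBy x₃ y) (h₁' : cs.ReflectionCovBy x₁ y')
    (h₂' : cs.ReflectionCovBy x₂ y') (h₃' : cs.ReflectionCovBy x₃ y') : y = y' := by
  by_contra hne
  have hprod (x : W) : (y⁻¹ * x) * (x⁻¹ * y') = y⁻¹ * y' := by group
  have hneq {x : W} (hx : cs.ReflectionCovBy x y) : y⁻¹ * x ≠ x⁻¹ * y' := by
    intro h
    have h1 := (isReflection_inv_mul_comm.mp hx.1).mul_self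
    nth_rw 2 [h] at h1
    rw [hprod, inv_mul_eq_one] at h1
    exact hne h1
  have hd {x x' : W} (h : x ≠ x') : y⁻¹ * x ≠ y⁻¹ * x' := fun h' ↦ h (mul_left_cancel h')
  have hlen {x : W} (hx : cs.ReflectionCovBy x y) :
      cs.length (y * (y⁻¹ * x)) + 1 = cs.length y := by
    rw [mul_inv_cancel_left, hx.2]
  obtain ⟨β₁, hr₁, hn₁, hy₁⟩ := h₁.exists_root
  obtain ⟨β₂, hr₂, hn₂, hy₂⟩ := h₂.exists_root
  obtain ⟨β₃, hr₃, hn₃, hy₃⟩ := h₃.exists_root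
  obtain ⟨γ₁, hs₁, -⟩ := h₁'.1.exists_nonneg_root
  obtain ⟨γ₂, hs₂, -⟩ := h₂'.1.exists_nonneg_root
  obtain ⟨γ₃, hs₃, -⟩ := h₃'.1.exists_nonneg_root
  obtain ⟨a₂, b₂, e₂⟩ := exists_combination_of_mul_eq hr₁ hs₁ hr₂ hs₂
    ((hprod _).trans (hprod _).symm) (hneq h₂)
  obtain ⟨a₃, b₃, e₃⟩ := exists_combination_of_mul_eq hr₁ hs₁ hr₃ hs₃
    ((hprod _).trans (hprod _).symm) (hneq h₃)
  have hb₂ : b₂ ≠ 0 := by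
    rintro rfl
    exact hd h₁₂.symm (hr₂.eq_of_smul hr₁ (c := a₂) (by rw [e₂]; module))
  have hb₃ : b₃ ≠ 0 := by
    rintro rfl
    exact hd h₁₃.symm (hr₃.eq_of_smul hr₁ (c := a₃) (by rw [e₃]; module))
  obtain ⟨p, q, e⟩ : ∃ p q : ℝ, β₃ = p • β₁ + q • β₂ := by
    refine ⟨a₃ - b₃ / b₂ * a₂, b₃ / b₂, ?_⟩
    have hb : b₃ = b₃ / b₂ * b₂ := by field_simp
    rw [e₂, e₃]
    nth_rw 1 [hb]
    module
  have hp : p ≠ 0 := by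
    rintro rfl
    exact hd h₂₃.symm (hr₃.eq_of_smul hr₂ (c := q) (by rw [e]; module))
  have hq : q ≠ 0 := by
    rintro rfl
    exact hd h₁₃.symm (hr₃.eq_of_smul hr₁ (c := p) (by rw [e]; module))
  rcases hp.lt_or_gt with hp' | hp' <;> rcases hq.lt_or_gt with hq' | hq'
  · refine hr₃.not_nonneg_neg hn₃ ?_
    rw [show -β₃ = (-p) • β₁ + (-q) • β₂ by rw [e]; module]
    exact (hn₁.smul (by linarith)).add (hn₂.smul (by linarith))
  · refine false_of_combination hr₃ hr₂ hr₁ (hd h₂₃.symm) (hd h₁₂) (inv_pos.mpr hq')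
      (mul_pos (inv_pos.mpr hq') (neg_pos.mpr hp')) ?_ hn₃ hn₁ hy₃ hy₁ (hlen h₂)
    rw [e, smul_add, smul_smul, smul_smul, inv_mul_cancel₀ hq]
    module
  · refine false_of_combination hr₃ hr₁ hr₂ (hd h₁₃.symm) (hd h₁₂.symm) (inv_pos.mpr hp')
      (mul_pos (inv_pos.mpr hp') (neg_pos.mpr hq')) ?_ hn₃ hn₂ hy₃ hy₂ (hlen h₁)
    rw [e, smul_add, smul_smul, smul_smul, inv_mul_cancel₀ hp]
    module
  · exact false_of_combination hr₁ hr₃ hr₂ (hd h₁₃) (hd h₂₃) hp' hq' e hn₁ hn₂ hy₁ hy₂ (hlen h₃)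

theorem isReflection_simple_mul (x y : W) (i : B) :
    cs.IsReflection ((cs.simple i * x)⁻¹ * (cs.simple i * y)) ↔ cs.IsReflection (x⁻¹ * y) := by
  rw [show (cs.simple i * x)⁻¹ * (cs.simple i * y) = x⁻¹ * y by group]

theorem ReflectionCovBy.simple_mul {x y : W} (h : cs.ReflectionCovBy x y) {i : B}
    (hl : cs.length (cs.simple i * y) = cs.length (cs.simple i * x) + 1) :
    cs.ReflectionCovBy (cs.simple i * x) (cs.simple i * y) :=
  ⟨(isReflection_simple_mul x y i).mpr h.1, hl⟩

theorem reflectionCovBy_simple_mul {x : W} {i : B}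
    (hl : cs.length (cs.simple i * x) = cs.length x + 1) :
    cs.ReflectionCovBy x (cs.simple i * x) :=
  ⟨⟨x⁻¹, i, by group⟩, hl⟩

theorem simple_mul_reflectionCovBy {x : W} {i : B}
    (hl : cs.length (cs.simple i * x) + 1 = cs.length x) :
    cs.ReflectionCovBy (cs.simple i * x) x := by
  have := cs.reflectionCovBy_simple_mul (x := cs.simple i * x) (i := i)
    (by rw [simple_mul_simple_cancel_left, hl])
  rwa [simple_mul_simple_cancel_left] at this

theorem ReflectionCovBy.eq_simple_mul {x y : W} (h : cs.ReflectionCovBy x y) {i : B}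
    (hx : cs.length (cs.simple i * x) = cs.length x + 1)
    (hy : cs.length (cs.simple i * y) + 1 = cs.length y) : y = cs.simple i * x := by
  have := h.1.mul_eq_simple_mul (w := x) (i := i) (by rw [mul_inv_cancel_left, h.2]; omega)
    (by rw [mul_inv_cancel_left]; have := h.2; omega)
  rwa [mul_inv_cancel_left] at this

theorem ReflectionCovBy.of_simple_mul_left {x y : W} {i : B}
    (h : cs.ReflectionCovBy (cs.simple i * x) y)
    (hl : cs.length (cs.simple i * y) = cs.length x + 1) :
    cs.ReflectionCovBy x (cs.simple i * y) := by
  have := h.simple_mul (i := i) (by rwa [simple_mul_simple_cancel_left])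
  rwa [simple_mul_simple_cancel_left] at this

theorem ReflectionCovBy.of_simple_mul_right {x y : W} {i : B}
    (h : cs.ReflectionCovBy x (cs.simple i * y))
    (hl : cs.length y = cs.length (cs.simple i * x) + 1) :
    cs.ReflectionCovBy (cs.simple i * x) y := by
  have := h.simple_mul (i := i) (by rwa [simple_mul_simple_cancel_left])
  rwa [simple_mul_simple_cancel_left] at this

theorem ReflectionCovBy.exists_leftDescent {x y : W} (h : cs.ReflectionCovBy x y) :
    ∃ i, cs.length (cs.simple i * y) + 1 = cs.length y := by
  have hy1 : y ≠ 1 := by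
    rintro rfl
    simpa using h.2
  obtain ⟨i, hi⟩ := cs.exists_leftDescent_of_ne_one hy1
  exact ⟨i, cs.isLeftDescent_iff.mp hi⟩

theorem length_simple_mul_simple_mul (x : W) (i : B) :
    cs.length (cs.simple i * (cs.simple i * x)) = cs.length x := by
  rw [simple_mul_simple_cancel_left]

theorem ReflectionCovBy.exists_ne_between {a x y : W} (hax : cs.ReflectionCovBy a x)
    (hxy : cs.ReflectionCovBy x y) :
    ∃ x', x' ≠ x ∧ cs.ReflectionCovBy a x' ∧ cs.ReflectionCovBy x' y := by
  induction hn : cs.length y generalizing a x y with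
  | zero =>
    have := hxy.2
    omega
  | succ n ih =>
  obtain ⟨i, hy⟩ := hxy.exists_leftDescent
  have la := hax.2
  have lx := hxy.2
  have lsa := length_simple_mul_simple_mul (cs := cs) a i
  have lsx := length_simple_mul_simple_mul (cs := cs) x i
  have lsy := length_simple_mul_simple_mul (cs := cs) y i
  rcases cs.length_simple_mul a i with ha | ha <;> rcases cs.length_simple_mul x i with hx | hx
  · have e := hxy.eq_simple_mul hx hy
    refine ⟨cs.simple i * a, ?_, reflectionCovBy_simple_mul ha, ?_⟩
    · rintro rfl
      omega
    · rw [e]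
      exact hax.simple_mul (by omega)
  · have e := hax.eq_simple_mul ha hx
    refine ⟨cs.simple i * y, ?_, ?_, simple_mul_reflectionCovBy hy⟩
    · rintro rfl
      omega
    · rw [e] at hxy
      exact hxy.of_simple_mul_left (by omega)
  · have e := hxy.eq_simple_mul hx hy
    have e' : cs.simple i * y = x := by rw [e, simple_mul_simple_cancel_left]
    obtain ⟨z, hz, haz, hzy⟩ := ih (simple_mul_reflectionCovBy ha) hax (by omega)
    have laz := haz.2
    rcases cs.length_simple_mul z i with hz' | hz'
    · refine ⟨cs.simple i * z, ?_, haz.of_simple_mul_left (by omega), ?_⟩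
      · rintro rfl
        rw [simple_mul_simple_cancel_left] at e
        subst e
        omega
      · rw [e]
        exact hzy.simple_mul (by omega)
    · have := haz.eq_simple_mul (by omega) hz'
      rw [simple_mul_simple_cancel_left] at this
      exact absurd this hz
  · obtain ⟨z, hz, haz, hzy⟩ := ih (hax.simple_mul (i := i) (by omega))
      (hxy.simple_mul (i := i) (by omega)) (by omega)
    have laz := haz.2
    rcases cs.length_simple_mul z i with hz' | hz'
    · refine ⟨cs.simple i * z, ?_, haz.of_simple_mul_left (by omega),
        hzy.of_simple_mul_right (by omega)⟩
      rintro rfl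
      rw [simple_mul_simple_cancel_left] at hz
      exact hz rfl
    · have := haz.eq_simple_mul (by omega) hz'
      rw [simple_mul_simple_cancel_left] at this
      subst this
      refine ⟨cs.simple i * y, ?_, hzy, simple_mul_reflectionCovBy hy⟩
      rintro rfl
      omega

theorem isReflection_of_simple_mul {x y : W} {i : B} (h : cs.IsReflection (x⁻¹ * y)) {x' y' : W}
    (hx : x = cs.simple i * x') (hy : y = cs.simple i * y') : cs.IsReflection (x'⁻¹ * y') := by
  subst hx hy
  exact (isReflection_simple_mul x' y' i).mp h

theorem ReflectionCovBy.isReflection_of_crown {a x x' y y' b : W} (hx : cs.ReflectionCovBy a x)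
    (hx' : cs.ReflectionCovBy a x') (hxy : cs.ReflectionCovBy x y)
    (hxy' : cs.ReflectionCovBy x y') (hx'y : cs.ReflectionCovBy x' y)
    (hx'y' : cs.ReflectionCovBy x' y') (hy : cs.ReflectionCovBy y b)
    (hy' : cs.ReflectionCovBy y' b) (hxx' : x ≠ x') (hyy' : y ≠ y') :
    cs.IsReflection (a⁻¹ * b) := by
  induction hn : cs.length b generalizing a x x' y y' b with
  | zero =>
    have := hy.2
    omega
  | succ n ih =>
  obtain ⟨i, hb⟩ := hy.exists_leftDescent
  have la := hx.2
  have la' := hx'.2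
  have lx := hxy.2
  have lx' := hxy'.2
  have ly := hy.2
  have ly' := hy'.2
  have ss (z : W) : cs.simple i * (cs.simple i * z) = z := cs.simple_mul_simple_cancel_left i
  have inj {z w : W} (h : cs.simple i * z = w) : z = cs.simple i * w := by rw [← h, ss]
  rcases cs.length_simple_mul a i with ha | ha
  · wlog hu : cs.length (cs.simple i * x') = cs.length x' + 1 generalizing x x'
    · refine this hx' hx hx'y hx'y' hxy hxy' hxx'.symm (by omega) (by omega) (by omega) (by omega)
        ((cs.length_simple_mul x i).resolve_right fun hd ↦ hxx' ?_)
      rw [hx.eq_simple_mul ha hd,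
        hx'.eq_simple_mul ha ((cs.length_simple_mul x' i).resolve_left hu)]
    wlog hu' : cs.length (cs.simple i * y') = cs.length y' + 1 generalizing y y'
    · refine this hy' hy hyy'.symm (by omega) (by omega) hxy' hxy hx'y' hx'y (by omega) (by omega)
        ((cs.length_simple_mul y i).resolve_right fun hd ↦ hyy' ?_)
      rw [hx'y.eq_simple_mul hu hd,
        hx'y'.eq_simple_mul hu ((cs.length_simple_mul y' i).resolve_left hu')]
    have eb := hy'.eq_simple_mul hu' hb
    rcases cs.length_simple_mul x i with hd | hd
    · exfalso
      rcases cs.length_simple_mul y i with hd' | hd'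
      · exact hyy' (mul_left_cancel ((hy.eq_simple_mul hd' hb).symm.trans eb))
      · exact hxx' (mul_left_cancel
          ((hxy.eq_simple_mul hd hd').symm.trans (hx'y.eq_simple_mul hu hd')))
    · exact isReflection_of_simple_mul hxy'.1 (hx.eq_simple_mul ha hd) (inj eb.symm)
  by_cases hdx : cs.length (cs.simple i * x) = cs.length x + 1 ∨
      cs.length (cs.simple i * x') = cs.length x' + 1
  · wlog hu : cs.length (cs.simple i * x) = cs.length x + 1 generalizing x x'
    · exact this hx' hx hx'y hx'y' hxy hxy' hxx'.symm (by omega) (by omega) (by omega) (by omega)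
        (hdx.symm) (by tauto)
    wlog hd : cs.length (cs.simple i * y) + 1 = cs.length y generalizing y y'
    · have hyu := (cs.length_simple_mul y i).resolve_right hd
      have ey := hy.eq_simple_mul hyu hb
      refine this hy' hy hyy'.symm (by omega) (by omega) hxy' hxy hx'y' hx'y (by omega) (by omega)
        ?_
      refine (cs.length_simple_mul y' i).resolve_left fun hyu' ↦ hyy' ?_
      have ey' := hy'.eq_simple_mul hyu' hb
      exact mul_left_cancel (ey.symm.trans ey')
    have ey := hxy.eq_simple_mul hu hd
    rcases cs.length_simple_mul y' i with hd' | hd'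
    · have eb := hy'.eq_simple_mul hd' hb
      have hdx' : cs.length (cs.simple i * x') + 1 = cs.length x' := by
        refine (cs.length_simple_mul x' i).resolve_left fun hu' ↦ hxx' ?_
        exact mul_left_cancel (ey.symm.trans (hx'y.eq_simple_mul hu' hd))
      have h1 : cs.ReflectionCovBy (cs.simple i * x') x := by
        have := hx'y.simple_mul (i := i) (by omega)
        rwa [ey, ss] at this
      have h2 := ih (simple_mul_reflectionCovBy ha) (hx'.simple_mul (i := i) (by omega)) hx hx'
        h1 (simple_mul_reflectionCovBy hdx') hxy' hx'y' (by
          intro h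
          rw [h, ss] at ha
          omega) hxx' (by omega)
      exact isReflection_of_simple_mul h2 rfl (inj eb.symm)
    · exact absurd (ey.trans (hxy'.eq_simple_mul hu hd').symm) hyy'
  push Not at hdx
  have hx1 := (cs.length_simple_mul x i).resolve_left hdx.1
  have hx1' := (cs.length_simple_mul x' i).resolve_left hdx.2
  by_cases hdy : cs.length (cs.simple i * y) = cs.length y + 1 ∨
      cs.length (cs.simple i * y') = cs.length y' + 1
  · exfalso
    wlog hu : cs.length (cs.simple i * y') = cs.length y' + 1 generalizing y y'
    · exact this hxy' hxy hx'y' hx'y hy' hy hyy'.symm (by omega) (by omega) (by omega) (by omega)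
        hdy.symm (by tauto)
    have eb := hy'.eq_simple_mul hu hb
    rcases cs.length_simple_mul y i with hd | hd
    · exact hyy' (mul_left_cancel ((hy.eq_simple_mul hd hb).symm.trans eb))
    have h1 : cs.ReflectionCovBy (cs.simple i * y) y' := by
      have := hy.simple_mul (i := i) (by omega)
      rwa [eb, ss] at this
    refine hyy' (ReflectionCovBy.eq_of_three_lower hxx' ?_ ?_ hxy hx'y
      (simple_mul_reflectionCovBy hd) hxy' hx'y' h1)
    · rintro rfl
      rw [ss] at hx1
      omega
    · rintro rfl
      rw [ss] at hx1'
      omega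
  push Not at hdy
  have hy1 := (cs.length_simple_mul y i).resolve_left hdy.1
  have hy1' := (cs.length_simple_mul y' i).resolve_left hdy.2
  have h := ih (hx.simple_mul (i := i) (by omega)) (hx'.simple_mul (i := i) (by omega))
    (hxy.simple_mul (i := i) (by omega)) (hxy'.simple_mul (i := i) (by omega))
    (hx'y.simple_mul (i := i) (by omega)) (hx'y'.simple_mul (i := i) (by omega))
    (hy.simple_mul (i := i) (by omega)) (hy'.simple_mul (i := i) (by omega))
    (fun h ↦ hxx' (mul_left_cancel h)) (fun h ↦ hyy' (mul_left_cancel h)) (by omega)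
  exact (isReflection_simple_mul a b i).mp h

end CoxeterSystem

section

variable {cs : CoxeterSystem M W} {x y : W}

theorem bruhatLE_eq_or_length_lt (h : bruhatLE cs x y) : x = y ∨ cs.length x < cs.length y := by
  induction h with
  | refl => exact Or.inl rfl
  | tail _ hs ih =>
    obtain ⟨t, -, -, hl⟩ := hs
    rcases ih with rfl | h
    exacts [Or.inr hl, Or.inr (h.trans hl)]

theorem bruhatCovBy_iff_reflectionCovBy : bruhatCovBy cs x y ↔ cs.ReflectionCovBy x y := by
  constructor
  · rintro ⟨h, hl⟩
    obtain rfl | ⟨z, hxz, t, ht, rfl, hlt⟩ := Relation.ReflTransGen.cases_tail h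
    · omega
    · obtain rfl | hlt' := bruhatLE_eq_or_length_lt hxz
      · exact ⟨by rwa [inv_mul_cancel_left], hl⟩
      · omega
  · rintro ⟨h, hl⟩
    exact ⟨.single ⟨x⁻¹ * y, h, by rw [mul_inv_cancel_left], by omega⟩, hl⟩

end

/-- A special matching of the Hasse diagram of `[u,v]` sends Bruhat covers (edges of the Hasse
diagram) to edges of the undirected Bruhat graph. -/
theorem stmt14 (cs : CoxeterSystem M W) (u v : W) (huv : bruhatLE cs u v)
    (Mch : W → W)
    (hmaps : ∀ x ∈ bruhatInterval cs u v, Mch x ∈ bruhatInterval cs u v)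
    (hinvol : ∀ x ∈ bruhatInterval cs u v, Mch (Mch x) = x)
    (hmatch : ∀ x ∈ bruhatInterval cs u v,
      bruhatCovBy cs x (Mch x) ∨ bruhatCovBy cs (Mch x) x)
    (hspecial : ∀ x ∈ bruhatInterval cs u v, ∀ y ∈ bruhatInterval cs u v,
      bruhatCovBy cs x y → Mch x = y ∨ bruhatLT cs (Mch x) (Mch y))
    (x y : W) (hx : x ∈ bruhatInterval cs u v) (hy : y ∈ bruhatInterval cs u v)
    (hxy : bruhatCovBy cs x y) :
    ∃ t : W, cs.IsReflection t ∧ Mch y = Mch x * t := by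
  have main : cs.IsReflection ((Mch x)⁻¹ * Mch y) := by
    simp only [bruhatCovBy_iff_reflectionCovBy] at hmatch hspecial hxy
    have lt_of {z w : W} (h : bruhatLT cs z w) : cs.length z < cs.length w :=
      (bruhatLE_eq_or_length_lt h.1).resolve_left h.2
    have cov_of {z w : W} (h : bruhatLT cs z w) (hl : cs.length w = cs.length z + 1) :
        cs.ReflectionCovBy z w :=
      bruhatCovBy_iff_reflectionCovBy.mp ⟨h.1, hl⟩
    have lxy := hxy.2
    rcases hspecial x hx y hy hxy with hM | hM
    · rw [hM, ← hM, hinvol x hx]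
      rw [← hM] at hxy
      exact CoxeterSystem.isReflection_inv_mul_comm.mp hxy.1
    have lM := lt_of hM
    rcases hmatch x hx with hMx | hMx <;> rcases hmatch y hy with hMy | hMy
    · exact (cov_of hM (by rw [hMx.2, hMy.2, lxy])).1
    · have := hMx.2
      have := hMy.2
      omega
    · obtain ⟨x', hne, hax', hx'y⟩ := hMx.exists_ne_between hxy
      have hax'B := bruhatCovBy_iff_reflectionCovBy.mpr hax'
      have hx'yB := bruhatCovBy_iff_reflectionCovBy.mpr hx'y
      have hx' : x' ∈ bruhatInterval cs u v :=
        ⟨(hmaps x hx).1.trans hax'B.1, hx'yB.1.trans hy.2⟩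
      have la := hMx.2
      have lx' := hax'.2
      have lb := hMy.2
      have hxM : bruhatLT cs x (Mch x') := by
        have := hspecial (Mch x) (hmaps x hx) x' hx' hax'
        rw [hinvol x hx] at this
        exact this.resolve_left (Ne.symm hne)
      have lx := lt_of hxM
      have hup : cs.ReflectionCovBy x' (Mch x') := by
        refine (hmatch x' hx').resolve_right fun h ↦ ?_
        have := h.2
        omega
      have lup := hup.2
      have hy' : y ≠ Mch x' := by
        intro h
        rw [h, hinvol x' hx'] at lb
        omega
      have hMM : bruhatLT cs (Mch x') (Mch y) :=
        (hspecial x' hx' y hy hx'y).resolve_left (Ne.symm hy')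
      exact hMx.isReflection_of_crown hax' hxy (cov_of hxM (by omega)) hx'y hup hMy
        (cov_of hMM (by omega)) (Ne.symm hne) hy'
    · exact (cov_of hM (by have := hMx.2; have := hMy.2; omega)).1
  exact ⟨_, main, by rw [mul_inv_cancel_left]⟩
end
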